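/- arXiv:2211.00950 — 3 statements merged into one kernel-verified Lean document; each statement's English description precedes it below -/
import Mathlib

section
/- Let k ∈ {1,…,6} and let λ = Σ_{i=1}^{6} a_i ϖ_i where the a_i are nonnegative integers and a_k = 0. Then T_{λ,k} ∩ ℤ = {1, 2, …, M_{λ,k}} if and only if for every integer t at least one of the following holds: (1) (λ+ρ−tϖ_k, α) > 0 for every α ∈ Φ⁺; (2) the number of α ∈ Φ⁺ with (λ+ρ−tϖ_k, α) < 0 equals the cardinality of Φ⁺_k and (λ+ρ−tϖ_k, α) ≠ 0 for every α ∈ Φ⁺; (3) there exists α ∈ Φ⁺ with (λ+ρ−tϖ_k, α) = 0. -/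
noncomputable section

/-- The ambient space ℝ^8. -/
abbrev V : Type := Fin 8 → ℝ

/-- The standard inner product on ℝ^8. -/
def ip (x y : V) : ℝ := ∑ i, x i * y i

/-- The standard basis vectors ε_1, …, ε_8 (indexed from 0). -/
def eps (i : Fin 8) : V := fun j => if j = i then 1 else 0

/-- The E8 root system: ±ε_i±ε_j (i<j) together with
    ½∑(−1)^{k(i)}ε_i where the number of minus signs is even. -/
def PhiE8 : Set V :=
  {α | (∃ i j : Fin 8, i < j ∧ ∃ s t : ℝ, (s = 1 ∨ s = -1) ∧ (t = 1 ∨ t = -1) ∧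
          α = s • eps i + t • eps j) ∨
       (∃ k : Fin 8 → Bool,
          Even ((Finset.univ.filter (fun i => k i = true)).card) ∧
          α = ∑ i, (if k i then (-(1 : ℝ)/2) else ((1 : ℝ)/2)) • eps i)}

/-- Simple roots α_1, …, α_8 of E8 (indexed from 0). -/
def sroot : Fin 8 → V :=
  ![(1/2 : ℝ) • (eps 0 - eps 1 - eps 2 - eps 3 - eps 4 - eps 5 - eps 6 + eps 7),
    eps 0 + eps 1,
    eps 1 - eps 0,
    eps 2 - eps 1,
    eps 3 - eps 2,
    eps 4 - eps 3,
    eps 5 - eps 4,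
    eps 6 - eps 5]

/-- The simple roots α_1, …, α_6 of E6. -/
def sroot6 : Fin 6 → V := fun i => sroot (Fin.castLE (by norm_num) i)

/-- The E6 root system: Φ_{E8} ∩ span_ℝ{α_1,…,α_6}. -/
def PhiE6 : Set V :=
  {α | α ∈ PhiE8 ∧ α ∈ Submodule.span ℝ (Set.range sroot6)}

/-- Positive roots of E6: elements of Φ_{E6} that are nonnegative
    combinations of the simple roots. -/
def Pos6 : Set V :=
  {α | α ∈ PhiE6 ∧ ∃ c : Fin 6 → ℝ, (∀ i, 0 ≤ c i) ∧ α = ∑ i, c i • sroot6 i}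

/-- Fundamental weights ϖ_1, …, ϖ_6 of E6 (indexed from 0). -/
def w6 : Fin 6 → V :=
  ![(2/3 : ℝ) • (-eps 5 - eps 6 + eps 7),
    (1/2 : ℝ) • (eps 0 + eps 1 + eps 2 + eps 3 + eps 4 - eps 5 - eps 6 + eps 7),
    (1/2 : ℝ) • (-eps 0 + eps 1 + eps 2 + eps 3 + eps 4) +
      (5/6 : ℝ) • (-eps 5 - eps 6 + eps 7),
    eps 2 + eps 3 + eps 4 - eps 5 - eps 6 + eps 7,
    eps 3 + eps 4 + (2/3 : ℝ) • (-eps 5 - eps 6 + eps 7),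
    eps 4 + (1/3 : ℝ) • (-eps 5 - eps 6 + eps 7)]

/-- ρ = ϖ_1 + ⋯ + ϖ_6. -/
def rho6 : V := ∑ i, w6 i

/-- Φ⁺_k = {α ∈ Φ⁺ : (ϖ_k, α) ≠ 0}. -/
def PhiK6 (k : Fin 6) : Set V := {α ∈ Pos6 | ip (w6 k) α ≠ 0}

/-- λ = ∑ a_i ϖ_i. -/
def lam6 (a : Fin 6 → ℕ) : V := ∑ i, (a i : ℝ) • w6 i

/-- T_{λ,k} = {(λ+ρ, α)/c_{α,k} : α ∈ Φ⁺_k}. -/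
def T6 (a : Fin 6 → ℕ) (k : Fin 6) : Set ℝ :=
  {r | ∃ α ∈ PhiK6 k, r = ip (lam6 a + rho6) α / ip (w6 k) α}

/-- M_{λ,k} = max T_{λ,k} (the set is finite and nonempty, so max = sSup). -/
def M6 (a : Fin 6 → ℕ) (k : Fin 6) : ℝ := sSup (T6 a k)

/-- The condition T_{λ,k} ∩ ℤ = {1, 2, …, M_{λ,k}}. -/
def ACM6 (a : Fin 6 → ℕ) (k : Fin 6) : Prop :=
  {n : ℤ | (n : ℝ) ∈ T6 a k} = {n : ℤ | 1 ≤ n ∧ (n : ℝ) ≤ M6 a k}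

lemma ip_add_left (x y z : V) : ip (x + y) z = ip x z + ip y z := by
  simp [ip, add_mul, Finset.sum_add_distrib]

lemma ip_sub_left (x y z : V) : ip (x - y) z = ip x z - ip y z := by
  simp [ip, sub_mul, Finset.sum_sub_distrib]

lemma ip_smul_left (r : ℝ) (x y : V) : ip (r • x) y = r * ip x y := by
  simp [ip, Finset.mul_sum, mul_assoc]

lemma ip_sum_left {ι : Type*} (s : Finset ι) (f : ι → V) (y : V) :
    ip (∑ i ∈ s, f i) y = ∑ i ∈ s, ip (f i) y := by
  simp only [ip, Finset.sum_apply, Finset.sum_mul]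
  exact Finset.sum_comm

lemma ip_sum_smul_right {ι : Type*} (s : Finset ι) (x : V) (c : ι → ℝ) (f : ι → V) :
    ip x (∑ i ∈ s, c i • f i) = ∑ i ∈ s, c i * ip x (f i) := by
  simp only [ip, Finset.sum_apply, Finset.mul_sum, Pi.smul_apply, smul_eq_mul]
  rw [Finset.sum_comm]
  exact Finset.sum_congr rfl fun i _ => Finset.sum_congr rfl fun j _ => by ring

lemma ip_neg_left (x y : V) : ip (-x) y = -ip x y := by
  simp [ip]

lemma ip_eps_left (i : Fin 8) (x : V) : ip (eps i) x = x i := by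
  simp [ip, eps]

lemma sroot6_eq : sroot6 =
    ![![1/2, -1/2, -1/2, -1/2, -1/2, -1/2, -1/2, 1/2],
      ![1, 1, 0, 0, 0, 0, 0, 0],
      ![-1, 1, 0, 0, 0, 0, 0, 0],
      ![0, -1, 1, 0, 0, 0, 0, 0],
      ![0, 0, -1, 1, 0, 0, 0, 0],
      ![0, 0, 0, -1, 1, 0, 0, 0]] := by
  ext k l
  fin_cases k <;> simp [sroot6, sroot] <;> fin_cases l <;> norm_num [eps, Fin.ext_iff]

/-- The fundamental weights are dual to the simple roots. -/
lemma ip_w6_sroot6 (i j : Fin 6) : ip (w6 i) (sroot6 j) = if i = j then 1 else 0 := by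
  rw [sroot6_eq]
  fin_cases i <;> simp [w6, ip_add_left, ip_sub_left, ip_neg_left, ip_smul_left, ip_eps_left] <;>
    fin_cases j <;> norm_num [Fin.ext_iff]

lemma ip_w6_sum (k : Fin 6) (c : Fin 6 → ℝ) : ip (w6 k) (∑ i, c i • sroot6 i) = c k := by
  simp [ip_sum_smul_right, ip_w6_sroot6]

lemma sum_half_smul_eps_apply (k : Fin 8 → Bool) (l : Fin 8) :
    (∑ i, (if k i then (-(1 : ℝ)/2) else ((1 : ℝ)/2)) • eps i) l =
      if k l then (-(1 : ℝ)/2) else ((1 : ℝ)/2) := by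
  simp only [Finset.sum_apply, Pi.smul_apply, eps, smul_eq_mul, mul_ite, mul_one, mul_zero,
    Finset.sum_ite_eq, Finset.mem_univ, if_true]

lemma finite_PhiE8 : PhiE8.Finite := by
  refine (Set.Finite.pi' (fun _ : Fin 8 =>
    Set.toFinite ({-1, -1/2, 0, 1/2, 1} : Set ℝ))).subset ?_
  rintro α (⟨i, j, hij, s, t, hs, ht, rfl⟩ | ⟨k, -, rfl⟩) l
  · have hne : ¬ (l = i ∧ l = j) := by
      rintro ⟨rfl, rfl⟩
      exact lt_irrefl _ hij
    by_cases hi : l = i <;> by_cases hj : l = j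
    · exact absurd ⟨hi, hj⟩ hne
    all_goals rcases hs with rfl | rfl <;> rcases ht with rfl | rfl <;> simp [eps, hi, hj]
    all_goals simp_all
  · rw [sum_half_smul_eps_apply]
    split_ifs <;> simp

lemma zero_notMem_PhiE8 : (0 : V) ∉ PhiE8 := by
  rintro (⟨i, j, hij, s, t, hs, -, h⟩ | ⟨k, -, h⟩)
  · have h' := congrFun h i
    simp only [Pi.zero_apply, Pi.add_apply, Pi.smul_apply, eps, hij.ne, if_true, if_false,
      smul_eq_mul, mul_one, mul_zero, add_zero] at h'
    rcases hs with rfl | rfl <;> norm_num at h'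
  · have h' := congrFun h 0
    rw [sum_half_smul_eps_apply] at h'
    split_ifs at h' <;> norm_num at h'

lemma finite_Pos6 : Pos6.Finite :=
  finite_PhiE8.subset fun _ h => h.1.1

lemma sroot6_mem_PhiE8 (k : Fin 6) : sroot6 k ∈ PhiE8 := by
  fin_cases k
  · refine Or.inr ⟨![false, true, true, true, true, true, true, false], by decide, ?_⟩
    ext l
    rw [sum_half_smul_eps_apply, sroot6_eq]
    fin_cases l <;> simp
  · exact Or.inl ⟨0, 1, by decide, 1, 1, by simp, by simp, by simp [sroot6, sroot]⟩
  · exact Or.inl ⟨0, 1, by decide, -1, 1, by simp, by simp, by simp [sroot6, sroot]; abel⟩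
  · exact Or.inl ⟨1, 2, by decide, -1, 1, by simp, by simp, by simp [sroot6, sroot]; abel⟩
  · exact Or.inl ⟨2, 3, by decide, -1, 1, by simp, by simp, by simp [sroot6, sroot]; abel⟩
  · exact Or.inl ⟨3, 4, by decide, -1, 1, by simp, by simp, by simp [sroot6, sroot]; abel⟩

lemma sroot6_mem_Pos6 (k : Fin 6) : sroot6 k ∈ Pos6 :=
  ⟨⟨sroot6_mem_PhiE8 k, Submodule.subset_span ⟨k, rfl⟩⟩,
    Pi.single k 1, fun i => by by_cases h : i = k <;> simp [h],
    by simp [Pi.single_apply]⟩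

lemma ip_w6_nonneg (k : Fin 6) {α : V} (hα : α ∈ Pos6) : 0 ≤ ip (w6 k) α := by
  obtain ⟨-, c, hc, rfl⟩ := hα
  rw [ip_w6_sum]
  exact hc k

lemma ip_lam6_add_rho6 (a : Fin 6 → ℕ) (α : V) :
    ip (lam6 a + rho6) α = ∑ i, ((a i : ℝ) + 1) * ip (w6 i) α := by
  simp [lam6, rho6, ip_add_left, ip_sum_left, ip_smul_left, add_mul, Finset.sum_add_distrib]

lemma ip_lam6_add_rho6_sroot6 (a : Fin 6 → ℕ) (k : Fin 6) :
    ip (lam6 a + rho6) (sroot6 k) = a k + 1 := by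
  simp [ip_lam6_add_rho6, ip_w6_sroot6]

/-- `λ + ρ` is strictly dominant. -/
lemma ip_lam6_add_rho6_pos (a : Fin 6 → ℕ) {α : V} (hα : α ∈ Pos6) :
    0 < ip (lam6 a + rho6) α := by
  rw [ip_lam6_add_rho6]
  have hterm : ∀ i ∈ Finset.univ, 0 ≤ ((a i : ℝ) + 1) * ip (w6 i) α := fun i _ =>
    mul_nonneg (by positivity) (ip_w6_nonneg i hα)
  refine (Finset.sum_nonneg hterm).lt_of_ne' fun h => ?_
  rw [Finset.sum_eq_zero_iff_of_nonneg hterm] at h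
  obtain ⟨⟨hE8, -⟩, c, -, rfl⟩ := hα
  refine zero_notMem_PhiE8 ?_
  have hc : ∀ i, c i = 0 := fun i => by
    rw [← ip_w6_sum i c]
    exact (mul_eq_zero.1 (h i (Finset.mem_univ i))).resolve_left (by positivity)
  simpa [hc] using hE8

lemma ip_w6_pos {k : Fin 6} {α : V} (hα : α ∈ PhiK6 k) : 0 < ip (w6 k) α :=
  (ip_w6_nonneg k hα.1).lt_of_ne' hα.2

lemma finite_T6 (a : Fin 6 → ℕ) (k : Fin 6) : (T6 a k).Finite := by
  refine ((finite_Pos6.subset fun _ h => h.1 : (PhiK6 k).Finite).image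
    fun α => ip (lam6 a + rho6) α / ip (w6 k) α).subset ?_
  rintro r ⟨α, hα, rfl⟩
  exact ⟨α, hα, rfl⟩

lemma le_M6 {a : Fin 6 → ℕ} {k : Fin 6} {r : ℝ} (hr : r ∈ T6 a k) : r ≤ M6 a k :=
  le_csSup (finite_T6 a k).bddAbove hr

lemma pos_of_mem_T6 {a : Fin 6 → ℕ} {k : Fin 6} {r : ℝ} (hr : r ∈ T6 a k) : 0 < r := by
  obtain ⟨α, hα, rfl⟩ := hr
  exact div_pos (ip_lam6_add_rho6_pos a hα.1) (ip_w6_pos hα)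

lemma one_mem_T6 {a : Fin 6 → ℕ} {k : Fin 6} (hk : a k = 0) : 1 ∈ T6 a k :=
  ⟨sroot6 k, ⟨sroot6_mem_Pos6 k, by simp [ip_w6_sroot6]⟩,
    by simp [ip_lam6_add_rho6_sroot6, ip_w6_sroot6, hk]⟩

lemma M6_mem_T6 {a : Fin 6 → ℕ} {k : Fin 6} (hk : a k = 0) : M6 a k ∈ T6 a k :=
  Set.Nonempty.csSup_mem ⟨1, one_mem_T6 hk⟩ (finite_T6 a k)

lemma ip_shift (a : Fin 6 → ℕ) (k : Fin 6) (t : ℝ) (α : V) :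
    ip (lam6 a + rho6 - t • w6 k) α = ip (lam6 a + rho6) α - t * ip (w6 k) α := by
  rw [ip_sub_left, ip_smul_left]

lemma forall_ip_shift_pos_iff (a : Fin 6 → ℕ) (k : Fin 6) (t : ℝ) :
    (∀ α ∈ Pos6, 0 < ip (lam6 a + rho6 - t • w6 k) α) ↔ ∀ r ∈ T6 a k, t < r := by
  constructor
  · rintro h _ ⟨α, hα, rfl⟩
    rw [lt_div_iff₀ (ip_w6_pos hα)]
    simpa [ip_shift] using h α hα.1
  · intro h α hα
    rw [ip_shift, sub_pos]
    by_cases hc : ip (w6 k) α = 0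
    · simpa [hc] using ip_lam6_add_rho6_pos a hα
    · exact (lt_div_iff₀ (ip_w6_pos ⟨hα, hc⟩)).1 (h _ ⟨α, ⟨hα, hc⟩, rfl⟩)

lemma exists_ip_shift_eq_zero_iff (a : Fin 6 → ℕ) (k : Fin 6) (t : ℝ) :
    (∃ α ∈ Pos6, ip (lam6 a + rho6 - t • w6 k) α = 0) ↔ t ∈ T6 a k := by
  constructor
  · rintro ⟨α, hα, h⟩
    rw [ip_shift, sub_eq_zero] at h
    have hc : ip (w6 k) α ≠ 0 := fun hc =>
      (ip_lam6_add_rho6_pos a hα).ne' (by rw [h, hc, mul_zero])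
    exact ⟨α, ⟨hα, hc⟩, by rw [h, mul_div_cancel_right₀ _ hc]⟩
  · rintro ⟨α, hα, rfl⟩
    exact ⟨α, hα.1, by rw [ip_shift, div_mul_cancel₀ _ hα.2, sub_self]⟩

lemma ncard_ip_shift_neg_eq_iff (a : Fin 6 → ℕ) (k : Fin 6) (t : ℝ) :
    {α ∈ Pos6 | ip (lam6 a + rho6 - t • w6 k) α < 0}.ncard = (PhiK6 k).ncard ↔
      ∀ r ∈ T6 a k, r < t := by
  have hsub : {α ∈ Pos6 | ip (lam6 a + rho6 - t • w6 k) α < 0} ⊆ PhiK6 k := by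
    rintro α ⟨hα, h⟩
    refine ⟨hα, fun hc => ?_⟩
    rw [ip_shift, hc, mul_zero, sub_zero] at h
    exact h.not_gt (ip_lam6_add_rho6_pos a hα)
  constructor
  · rintro h _ ⟨α, hα, rfl⟩
    have hfin : (PhiK6 k).Finite := finite_Pos6.subset fun _ h => h.1
    rw [← Set.eq_of_subset_of_ncard_le hsub h.ge hfin] at hα
    have hneg := hα.2
    rw [ip_shift, sub_neg] at hneg
    exact (div_lt_iff₀ (ip_w6_pos (hsub hα))).2 hneg
  · intro h
    congr 1
    refine hsub.antisymm fun α hα => ⟨hα.1, ?_⟩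
    rw [ip_shift, sub_neg]
    exact (div_lt_iff₀ (ip_w6_pos hα)).1 (h _ ⟨α, hα, rfl⟩)

/-- the Borel–Weil–Bott criterion for `T_{λ,k} ∩ ℤ = [1, M_{λ,k}]`
    on E6/P_{α_k}. -/
theorem stmt0 (k : Fin 6) (a : Fin 6 → ℕ) (hk : a k = 0) :
    ACM6 a k ↔
      ∀ t : ℤ,
        (∀ α ∈ Pos6, 0 < ip (lam6 a + rho6 - (t : ℝ) • w6 k) α) ∨
        ({α ∈ Pos6 | ip (lam6 a + rho6 - (t : ℝ) • w6 k) α < 0}.ncard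
            = (PhiK6 k).ncard ∧
          ∀ α ∈ Pos6, ip (lam6 a + rho6 - (t : ℝ) • w6 k) α ≠ 0) ∨
        (∃ α ∈ Pos6, ip (lam6 a + rho6 - (t : ℝ) • w6 k) α = 0) := by
  have hzero := exists_ip_shift_eq_zero_iff a k
  constructor
  · intro h t
    rw [forall_ip_shift_pos_iff, ncard_ip_shift_neg_eq_iff, hzero]
    have ht : (t : ℝ) ∈ T6 a k ↔ 1 ≤ t ∧ (t : ℝ) ≤ M6 a k := Set.ext_iff.1 h t
    by_cases hT : (t : ℝ) ∈ T6 a k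
    · exact Or.inr (Or.inr hT)
    rcases lt_or_ge t 1 with h1 | h1
    · refine Or.inl fun r hr => lt_of_le_of_lt ?_ (pos_of_mem_T6 hr)
      exact_mod_cast Int.lt_add_one_iff.1 h1
    · have hM : M6 a k < t := not_le.1 fun hM => hT (ht.2 ⟨h1, hM⟩)
      exact Or.inr (Or.inl ⟨fun r hr => (le_M6 hr).trans_lt hM,
        fun α hα h0 => hT ((hzero t).1 ⟨α, hα, h0⟩)⟩)
  · intro h
    ext n
    simp only [Set.mem_ofPred_eq]
    refine ⟨fun hn => ⟨by exact_mod_cast pos_of_mem_T6 hn, le_M6 hn⟩, fun ⟨h1, hM⟩ => ?_⟩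
    have hn := h n
    rw [forall_ip_shift_pos_iff, ncard_ip_shift_neg_eq_iff, hzero] at hn
    rcases hn with hlt | ⟨hgt, -⟩ | hn
    · have h2 : n < 1 := by exact_mod_cast hlt 1 (one_mem_T6 hk)
      exact absurd h1 h2.not_ge
    · exact absurd hM (hgt _ (M6_mem_T6 hk)).not_ge
    · exact hn
end
end

section
/- Let λ = Σ_{i=1}^{7} a_i ϖ_i with all a_i nonnegative integers. Then M_{λ,k} equals: a_1+2a_2+3a_3+4a_4+3a_5+2a_6+a_7+16 if k = 1; a_1+a_2+2a_3+3a_4+3a_5+2a_6+a_7+13 if k = 2; a_1+a_2+a_3+2a_4+2a_5+2a_6+a_7+10 if k = 3; a_1+a_2+a_3+a_4+a_5+a_6+a_7+7 if k = 4; a_1+a_2+2a_3+2a_4+a_5+a_6+a_7+9 if k = 5; a_1+2a_2+2a_3+3a_4+2a_5+a_6+a_7+12 if k = 6; and 2a_1+2a_2+3a_3+4a_4+3a_5+2a_6+a_7+17 if k = 7. -/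
noncomputable section

/-- The simple roots α_1, …, α_7 of E7. -/
def sroot7 : Fin 7 → V := fun i => sroot (Fin.castLE (by norm_num) i)

/-- The E7 root system: Φ_{E8} ∩ span_ℝ{α_1,…,α_7}. -/
def PhiE7 : Set V :=
  {α | α ∈ PhiE8 ∧ α ∈ Submodule.span ℝ (Set.range sroot7)}

/-- Positive roots of E7: elements of Φ_{E7} that are nonnegative
    combinations of the simple roots. -/
def Pos7 : Set V :=
  {α | α ∈ PhiE7 ∧ ∃ c : Fin 7 → ℝ, (∀ i, 0 ≤ c i) ∧ α = ∑ i, c i • sroot7 i}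

/-- Fundamental weights ϖ_1, …, ϖ_7 of E7 (indexed from 0). -/
def w7 : Fin 7 → V :=
  ![-eps 6 + eps 7,
    (1/2 : ℝ) • (eps 0 + eps 1 + eps 2 + eps 3 + eps 4 + eps 5) - eps 6 + eps 7,
    (1/2 : ℝ) • (-eps 0 + eps 1 + eps 2 + eps 3 + eps 4 + eps 5
      - (3 : ℝ) • eps 6 + (3 : ℝ) • eps 7),
    eps 2 + eps 3 + eps 4 + eps 5 - (2 : ℝ) • eps 6 + (2 : ℝ) • eps 7,
    eps 3 + eps 4 + eps 5 - (3/2 : ℝ) • (eps 6 - eps 7),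
    eps 4 + eps 5 - eps 6 + eps 7,
    eps 5 - (1/2 : ℝ) • (eps 6 - eps 7)]

/-- ρ = ϖ_1 + ⋯ + ϖ_7. -/
def rho7 : V := ∑ i, w7 i

/-- Φ⁺_k = {α ∈ Φ⁺ : (ϖ_k, α) ≠ 0}. -/
def PhiK7 (k : Fin 7) : Set V := {α ∈ Pos7 | ip (w7 k) α ≠ 0}

/-- λ = ∑ a_i ϖ_i. -/
def lam7 (a : Fin 7 → ℕ) : V := ∑ i, (a i : ℝ) • w7 i

/-- T_{λ,k} = {(λ+ρ, α)/c_{α,k} : α ∈ Φ⁺_k}. -/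
def T7 (a : Fin 7 → ℕ) (k : Fin 7) : Set ℝ :=
  {r | ∃ α ∈ PhiK7 k, r = ip (lam7 a + rho7) α / ip (w7 k) α}

/-- M_{λ,k} = max T_{λ,k} (the set is finite and nonempty, so max = sSup). -/
def M7 (a : Fin 7 → ℕ) (k : Fin 7) : ℝ := sSup (T7 a k)

/-- The condition T_{λ,k} ∩ ℤ = {1, 2, …, M_{λ,k}}. -/
def ACM7 (a : Fin 7 → ℕ) (k : Fin 7) : Prop :=
  {n : ℤ | (n : ℝ) ∈ T7 a k} = {n : ℤ | 1 ≤ n ∧ (n : ℝ) ≤ M7 a k}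

/-- The doubled coordinates of the simple roots of E8. -/
def dblSimple : Fin 8 → Fin 8 → ℤ :=
  ![![1, -1, -1, -1, -1, -1, -1, 1],
    ![2, 2, 0, 0, 0, 0, 0, 0],
    ![-2, 2, 0, 0, 0, 0, 0, 0],
    ![0, -2, 2, 0, 0, 0, 0, 0],
    ![0, 0, -2, 2, 0, 0, 0, 0],
    ![0, 0, 0, -2, 2, 0, 0, 0],
    ![0, 0, 0, 0, -2, 2, 0, 0],
    ![0, 0, 0, 0, 0, -2, 2, 0]]

/-- The doubled coordinates of the simple roots of E7. -/
def dblSimple7 (i : Fin 7) : Fin 8 → ℤ := dblSimple (Fin.castLE (by norm_num) i)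

/-- `topCoeff k` lists the coordinates, in the simple roots, of the highest root of E7 among those
with `k`-th coordinate equal to `1`. -/
def topCoeff : Fin 7 → Fin 7 → ℤ :=
  ![![1, 2, 3, 4, 3, 2, 1],
    ![1, 1, 2, 3, 3, 2, 1],
    ![1, 1, 1, 2, 2, 2, 1],
    ![1, 1, 1, 1, 1, 1, 1],
    ![1, 1, 2, 2, 1, 1, 1],
    ![1, 2, 2, 3, 2, 1, 1],
    ![2, 2, 3, 4, 3, 2, 1]]

/-- Four times the pairing of the `i`-th fundamental weight with the vector `x / 2`. -/
def dblPairing (i : Fin 7) (x : Fin 8 → ℤ) : ℤ :=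
  match i with
  | 0 => 2 * (x 7 - x 6)
  | 1 => x 0 + x 1 + x 2 + x 3 + x 4 + x 5 + 2 * (x 7 - x 6)
  | 2 => -x 0 + x 1 + x 2 + x 3 + x 4 + x 5 + 3 * (x 7 - x 6)
  | 3 => 2 * (x 2 + x 3 + x 4 + x 5) + 4 * (x 7 - x 6)
  | 4 => 2 * (x 3 + x 4 + x 5) + 3 * (x 7 - x 6)
  | 5 => 2 * (x 4 + x 5) + 2 * (x 7 - x 6)
  | 6 => 2 * x 5 + (x 7 - x 6)

/-- If `x / 2` pairs nonnegatively with all fundamental weights and lies in the span of E7, then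
its coordinates are dominated by multiples of `topCoeff k` whenever the `k`-th one is nonzero. -/
abbrev TopDominated (x : Fin 8 → ℤ) : Prop :=
  x 6 + x 7 = 0 → (∀ i, 0 ≤ dblPairing i x) →
    ∀ k, dblPairing k x ≠ 0 → ∀ i, dblPairing i x ≤ topCoeff k i * dblPairing k x

/-- The doubled coordinates of `± ε_i ± ε_j`. -/
def dblVectorRoot (i j : Fin 8) (s t : Bool) (l : Fin 8) : ℤ :=
  (bif s then 2 else -2) * (if l = i then 1 else 0) +
    (bif t then 2 else -2) * (if l = j then 1 else 0)

/-- The doubled coordinates of a half-spin vector. -/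
def dblSpinRoot (k : Fin 8 → Bool) (l : Fin 8) : ℤ := bif k l then -1 else 1

theorem topDominated_dblVectorRoot :
    ∀ i j : Fin 8, i < j → ∀ s t : Bool, TopDominated (dblVectorRoot i j s t) := by
  decide +kernel

theorem topDominated_dblSpinRoot :
    ∀ k : Fin 8 → Bool, Even ((Finset.univ.filter (fun i => k i = true)).card) →
      TopDominated (dblSpinRoot k) := by
  decide +kernel

theorem sum_smul_eps_apply (f : Fin 8 → ℝ) (l : Fin 8) : (∑ i, f i • eps i) l = f l := by
  simp [eps, Finset.sum_apply]

theorem PhiE8.exists_dbl {α : V} (hα : α ∈ PhiE8) :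
    ∃ x : Fin 8 → ℤ, TopDominated x ∧ ∀ l, α l = (x l : ℝ) / 2 := by
  rcases hα with ⟨i, j, hij, s, t, hs, ht, rfl⟩ | ⟨k, hk, rfl⟩
  · have sign : ∀ r : ℝ, r = 1 ∨ r = -1 → ∃ b : Bool, r = ((bif b then 2 else -2 : ℤ) : ℝ) / 2 := by
      rintro r (rfl | rfl)
      · exact ⟨true, by norm_num⟩
      · exact ⟨false, by norm_num⟩
    obtain ⟨b, hb⟩ := sign s hs
    obtain ⟨c, hc⟩ := sign t ht
    refine ⟨_, topDominated_dblVectorRoot i j hij b c, fun l => ?_⟩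
    simp only [hb, hc, dblVectorRoot, eps, Pi.add_apply, Pi.smul_apply, smul_eq_mul]
    push_cast
    ring
  · refine ⟨_, topDominated_dblSpinRoot k hk, fun l => ?_⟩
    rw [sum_smul_eps_apply, dblSpinRoot]
    cases k l <;> norm_num

theorem sroot_apply (i l : Fin 8) : sroot i l = (dblSimple i l : ℝ) / 2 := by
  fin_cases i <;> fin_cases l <;> norm_num [sroot, dblSimple, eps, Fin.ext_iff]

theorem sroot7_apply (i : Fin 7) (l : Fin 8) : sroot7 i l = (dblSimple7 i l : ℝ) / 2 :=
  sroot_apply _ l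

theorem ip_w7_eq (i : Fin 7) {α : V} {x : Fin 8 → ℤ} (h : ∀ l, α l = (x l : ℝ) / 2) :
    ip (w7 i) α = (dblPairing i x : ℝ) / 4 := by
  fin_cases i <;> simp [ip, w7, eps, h, dblPairing, Fin.sum_univ_eight] <;> ring

theorem ip_sum_smul_left {n : ℕ} (c : Fin n → ℝ) (v : Fin n → V) (z : V) :
    ip (∑ i, c i • v i) z = ∑ i, c i * ip (v i) z := by
  simp only [ip, Finset.sum_apply, Pi.smul_apply, smul_eq_mul, Finset.sum_mul, Finset.mul_sum]
  rw [Finset.sum_comm]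
  simp only [mul_assoc]

theorem ip_comm (x y : V) : ip x y = ip y x := by
  simp only [ip, mul_comm]

theorem ip_w7_sroot7 (i j : Fin 7) : ip (w7 i) (sroot7 j) = if j = i then 1 else 0 := by
  have h : dblPairing i (dblSimple7 j) = if j = i then 4 else 0 := by
    revert i j
    decide +kernel
  rw [ip_w7_eq i (sroot7_apply j), h]
  split_ifs <;> norm_num

theorem ip_w7_sum_sroot7 (i : Fin 7) (c : Fin 7 → ℝ) :
    ip (w7 i) (∑ j, c j • sroot7 j) = c i := by
  rw [ip_comm, ip_sum_smul_left]
  simp [ip_comm _ (w7 i), ip_w7_sroot7]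

theorem ip_lam7_add_rho7 (a : Fin 7 → ℕ) (α : V) :
    ip (lam7 a + rho7) α = ∑ i, ((a i : ℝ) + 1) * ip (w7 i) α := by
  have h : lam7 a + rho7 = ∑ i, ((a i : ℝ) + 1) • w7 i := by
    simp [lam7, rho7, add_smul, Finset.sum_add_distrib]
  rw [h, ip_sum_smul_left]

theorem sroot7_apply_six_add_seven (i : Fin 7) : sroot7 i 6 + sroot7 i 7 = 0 := by
  have h : dblSimple7 i 6 + dblSimple7 i 7 = 0 := by
    revert i
    decide +kernel
  rw [sroot7_apply, sroot7_apply, ← add_div, ← Int.cast_add, h]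
  simp

theorem ip_w7_le_of_mem_PhiK7 {k : Fin 7} {α : V} (hα : α ∈ PhiK7 k) :
    0 < ip (w7 k) α ∧ ∀ i, ip (w7 i) α ≤ topCoeff k i * ip (w7 k) α := by
  obtain ⟨⟨⟨hE8, -⟩, c, hc, hsum⟩, hk⟩ := hα
  have hnonneg (i : Fin 7) : 0 ≤ ip (w7 i) α := by
    rw [hsum, ip_w7_sum_sroot7]
    exact hc i
  have hlast : α 6 + α 7 = 0 := by
    simp only [hsum, Finset.sum_apply, Pi.smul_apply, smul_eq_mul, ← Finset.sum_add_distrib,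
      ← mul_add, sroot7_apply_six_add_seven, mul_zero, Finset.sum_const_zero]
  obtain ⟨x, hx, hαx⟩ := PhiE8.exists_dbl hE8
  refine ⟨lt_of_le_of_ne (hnonneg k) hk.symm, fun i => ?_⟩
  have hx0 : x 6 + x 7 = 0 := by
    rw [hαx, hαx] at hlast
    exact_mod_cast (by linarith : (x 6 : ℝ) + x 7 = 0)
  have hx1 (i : Fin 7) : 0 ≤ dblPairing i x := by
    have := hnonneg i
    rw [ip_w7_eq i hαx] at this
    exact_mod_cast (by linarith : (0 : ℝ) ≤ dblPairing i x)
  have hx2 : dblPairing k x ≠ 0 := by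
    intro h
    exact hk (by rw [ip_w7_eq k hαx, h]; simp)
  have := hx hx0 hx1 k hx2 i
  have : (dblPairing i x : ℝ) ≤ topCoeff k i * dblPairing k x := by exact_mod_cast this
  rw [ip_w7_eq i hαx, ip_w7_eq k hαx]
  linarith

/-- The highest root of E7 among those with `k`-th coordinate equal to `1`. -/
def topRoot (k : Fin 7) : V := ∑ i, (topCoeff k i : ℝ) • sroot7 i

/-- The doubled coordinates of `topRoot k`. -/
def dblTopRoot (k : Fin 7) (l : Fin 8) : ℤ :=
  topCoeff k 0 * dblSimple7 0 l + topCoeff k 1 * dblSimple7 1 l + topCoeff k 2 * dblSimple7 2 l +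
    topCoeff k 3 * dblSimple7 3 l + topCoeff k 4 * dblSimple7 4 l + topCoeff k 5 * dblSimple7 5 l +
    topCoeff k 6 * dblSimple7 6 l

theorem topRoot_apply (k : Fin 7) (l : Fin 8) :
    topRoot k l = (dblTopRoot k l : ℝ) / 2 := by
  simp only [topRoot, Finset.sum_apply, Pi.smul_apply, smul_eq_mul, sroot7_apply, dblTopRoot,
    Fin.sum_univ_seven]
  push_cast
  ring

theorem topRoot_mem_PhiE8 (k : Fin 7) : topRoot k ∈ PhiE8 := by
  by_cases hk : k = 6
  · refine Or.inl ⟨6, 7, by decide, -1, 1, Or.inr rfl, Or.inl rfl, ?_⟩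
    subst hk
    ext l
    have h : dblTopRoot 6 l =
        -2 * (if l = 6 then 1 else 0) + 2 * (if l = 7 then 1 else 0) := by
      revert l
      decide +kernel
    rw [topRoot_apply, h]
    simp only [eps, Pi.add_apply, Pi.smul_apply, smul_eq_mul]
    push_cast
    ring
  · have h : ∀ k : Fin 7, k ≠ 6 → ∀ l, dblTopRoot k l =
        if dblTopRoot k l < 0 then -1 else 1 := by
      decide +kernel
    have heven : ∀ k : Fin 7, k ≠ 6 → Even (Finset.univ.filter fun l =>
        decide (dblTopRoot k l < 0) = true).card := by
      decide +kernel
    refine Or.inr ⟨fun l => decide (dblTopRoot k l < 0), heven k hk, ?_⟩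
    ext l
    have hl := h k hk l
    rw [sum_smul_eps_apply, topRoot_apply]
    simp only [decide_eq_true_eq]
    generalize dblTopRoot k l = x at hl ⊢
    split_ifs at hl ⊢ <;> simp [hl]

theorem ip_w7_topRoot (i k : Fin 7) : ip (w7 i) (topRoot k) = topCoeff k i :=
  ip_w7_sum_sroot7 i _

theorem topCoeff_self (k : Fin 7) : topCoeff k k = 1 := by
  revert k
  decide

theorem topCoeff_nonneg (k i : Fin 7) : 0 ≤ topCoeff k i := by
  revert k i
  decide

theorem topRoot_mem_PhiK7 (k : Fin 7) : topRoot k ∈ PhiK7 k := by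
  refine ⟨⟨⟨topRoot_mem_PhiE8 k, ?_⟩, fun i => topCoeff k i, fun i => ?_, rfl⟩, ?_⟩
  · exact Submodule.sum_mem _ fun i _ =>
      Submodule.smul_mem _ _ (Submodule.subset_span ⟨i, rfl⟩)
  · exact Int.cast_nonneg (topCoeff_nonneg k i)
  · simp [ip_w7_topRoot, topCoeff_self]

theorem isGreatest_T7 (a : Fin 7 → ℕ) (k : Fin 7) :
    IsGreatest (T7 a k) (∑ i, ((a i : ℝ) + 1) * topCoeff k i) := by
  constructor
  · refine ⟨topRoot k, topRoot_mem_PhiK7 k, ?_⟩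
    simp [ip_lam7_add_rho7, ip_w7_topRoot, topCoeff_self]
  · rintro r ⟨α, hα, rfl⟩
    obtain ⟨hpos, hle⟩ := ip_w7_le_of_mem_PhiK7 hα
    rw [div_le_iff₀ hpos, ip_lam7_add_rho7, Finset.sum_mul]
    refine Finset.sum_le_sum fun i _ => ?_
    rw [mul_assoc]
    exact mul_le_mul_of_nonneg_left (hle i) (by positivity)

theorem M7_eq (a : Fin 7 → ℕ) (k : Fin 7) :
    M7 a k = ∑ i, ((a i : ℝ) + 1) * topCoeff k i :=
  (isGreatest_T7 a k).csSup_eq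

/-- the values of M_{λ,k} for E7 (k = 1,…,7 is indexed here
    by 0,…,6). -/
theorem stmt6 (a : Fin 7 → ℕ) :
    M7 a 0 = (a 0 : ℝ) + 2 * (a 1 : ℝ) + 3 * (a 2 : ℝ) + 4 * (a 3 : ℝ)
        + 3 * (a 4 : ℝ) + 2 * (a 5 : ℝ) + (a 6 : ℝ) + 16 ∧
    M7 a 1 = (a 0 : ℝ) + (a 1 : ℝ) + 2 * (a 2 : ℝ) + 3 * (a 3 : ℝ)
        + 3 * (a 4 : ℝ) + 2 * (a 5 : ℝ) + (a 6 : ℝ) + 13 ∧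
    M7 a 2 = (a 0 : ℝ) + (a 1 : ℝ) + (a 2 : ℝ) + 2 * (a 3 : ℝ)
        + 2 * (a 4 : ℝ) + 2 * (a 5 : ℝ) + (a 6 : ℝ) + 10 ∧
    M7 a 3 = (a 0 : ℝ) + (a 1 : ℝ) + (a 2 : ℝ) + (a 3 : ℝ)
        + (a 4 : ℝ) + (a 5 : ℝ) + (a 6 : ℝ) + 7 ∧
    M7 a 4 = (a 0 : ℝ) + (a 1 : ℝ) + 2 * (a 2 : ℝ) + 2 * (a 3 : ℝ)
        + (a 4 : ℝ) + (a 5 : ℝ) + (a 6 : ℝ) + 9 ∧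
    M7 a 5 = (a 0 : ℝ) + 2 * (a 1 : ℝ) + 2 * (a 2 : ℝ) + 3 * (a 3 : ℝ)
        + 2 * (a 4 : ℝ) + (a 5 : ℝ) + (a 6 : ℝ) + 12 ∧
    M7 a 6 = 2 * (a 0 : ℝ) + 2 * (a 1 : ℝ) + 3 * (a 2 : ℝ) + 4 * (a 3 : ℝ)
        + 3 * (a 4 : ℝ) + 2 * (a 5 : ℝ) + (a 6 : ℝ) + 17 := by
  refine ⟨?_, ?_, ?_, ?_, ?_, ?_, ?_⟩ <;>
    · rw [M7_eq]
      simp [topCoeff, Fin.sum_univ_seven]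
      ring
end
end

section
/- Let λ = Σ_{i=1}^{6} a_i ϖ_i with all a_i nonnegative integers and a_1 = 0. Then T_{λ,1} ∩ ℤ = {1, 2, …, M_{λ,1}} if and only if (a_1,a_2,a_3,a_4,a_5,a_6) = (0,0,0,0,i,j) for some i ∈ {0,1} and j ∈ {0,1,2,3}. (This is the combinatorial criterion, via the main theorem, for an initialized irreducible homogeneous vector bundle on the Cayley plane E6/P_{α_1} with highest weight λ to be an ACM bundle.) -/
noncomputable section

/-- Coefficient vectors, in the simple roots, of the positive roots of E6 that involve `α₁`. -/
def cayleyCoeffs : List (Fin 6 → ℕ) :=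
  [![1, 0, 0, 0, 0, 0], ![1, 0, 1, 0, 0, 0], ![1, 0, 1, 1, 0, 0], ![1, 1, 1, 1, 0, 0],
   ![1, 0, 1, 1, 1, 0], ![1, 1, 1, 1, 1, 0], ![1, 0, 1, 1, 1, 1], ![1, 1, 1, 2, 1, 0],
   ![1, 1, 1, 1, 1, 1], ![1, 1, 2, 2, 1, 0], ![1, 1, 1, 2, 1, 1], ![1, 1, 2, 2, 1, 1],
   ![1, 1, 1, 2, 2, 1], ![1, 1, 2, 2, 2, 1], ![1, 1, 2, 3, 2, 1], ![1, 2, 2, 3, 2, 1]]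

/-- The linear combination of the simple roots of E6 with coefficients `c`. -/
def rootComb (c : Fin 6 → ℝ) : V := ∑ i, c i • sroot6 i

lemma rootComb_eq (c : Fin 6 → ℝ) :
    rootComb c = ![c 0 / 2 + c 1 - c 2, -c 0 / 2 + c 1 + c 2 - c 3, -c 0 / 2 + c 3 - c 4,
      -c 0 / 2 + c 4 - c 5, -c 0 / 2 + c 5, -c 0 / 2, -c 0 / 2, c 0 / 2] := by
  ext j
  fin_cases j <;>
    simp [rootComb, Fin.sum_univ_six, sroot6, sroot, eps, Fin.castLE] <;> ring

lemma ip_w6_rootComb (c : Fin 6 → ℝ) (i : Fin 6) : ip (w6 i) (rootComb c) = c i := by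
  rw [rootComb_eq]
  fin_cases i <;> simp [ip, w6, eps, Fin.sum_univ_eight] <;> ring

lemma ip_sum_smul_left_s14 {ι : Type*} [Fintype ι] (b : ι → ℝ) (w : ι → V) (x : V) :
    ip (∑ i, b i • w i) x = ∑ i, b i * ip (w i) x := by
  simp only [ip, Finset.sum_apply, Pi.smul_apply, smul_eq_mul, Finset.sum_mul, Finset.mul_sum]
  rw [Finset.sum_comm]
  simp only [mul_assoc]

lemma ip_lam6_add_rho6_rootComb (a : Fin 6 → ℕ) (c : Fin 6 → ℝ) :
    ip (lam6 a + rho6) (rootComb c) = ∑ i, ((a i : ℝ) + 1) * c i := by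
  have : lam6 a + rho6 = ∑ i, ((a i : ℝ) + 1) • w6 i := by
    simp [lam6, rho6, add_smul, Finset.sum_add_distrib]
  rw [this, ip_sum_smul_left_s14]
  simp only [ip_w6_rootComb]

/-- The coordinates of a half-spin vector are its prescribed signs, halved. -/
lemma sum_sign_smul_eps (k : Fin 8 → Bool) :
    (∑ i, (if k i then (-(1 : ℝ) / 2) else ((1 : ℝ) / 2)) • eps i)
      = fun j => if k j then (-(1 : ℝ) / 2) else ((1 : ℝ) / 2) := by
  ext j
  simp [Finset.sum_apply, eps, -ite_smul]

/-- The coefficient vector of the half-spin root whose first five minus signs are given by `k`. -/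
def spinCoeffs (k : Fin 5 → Bool) : Fin 6 → ℕ :=
  let e : Fin 5 → ℕ := fun i => if k i then 0 else 1
  ![1, (e 0 + e 1 + e 2 + e 3 + e 4) / 2, (e 0 + e 1 + e 2 + e 3 + e 4 + 1) / 2 - e 0,
    e 2 + e 3 + e 4, e 3 + e 4, e 4]

lemma mem_cayleyCoeffs_iff {c : Fin 6 → ℕ} : c ∈ cayleyCoeffs ↔
    ∃ s : Fin 5 → Bool, Even ((Finset.univ.filter fun i => s i = true).card) ∧
      spinCoeffs s = c := by
  constructor
  · revert c
    change ∀ c ∈ cayleyCoeffs, _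
    decide
  · rintro ⟨s, hs, rfl⟩
    revert s
    decide

/-- Extension of five signs by the signs `-, -, +` common to the roots that involve `α₁`. -/
def extendSigns (s : Fin 5 → Bool) : Fin 8 → Bool :=
  ![s 0, s 1, s 2, s 3, s 4, true, true, false]

lemma even_card_extendSigns : ∀ s : Fin 5 → Bool,
    Even ((Finset.univ.filter fun i => extendSigns s i = true).card) ↔
      Even ((Finset.univ.filter fun i => s i = true).card) := by
  decide

lemma two_mul_coords_spinCoeffs : ∀ s : Fin 5 → Bool,
    Even ((Finset.univ.filter fun i => s i = true).card) → ∀ j : Fin 8,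
      (let c : Fin 6 → ℤ := fun i => spinCoeffs s i
       ![c 0 + 2 * c 1 - 2 * c 2, -c 0 + 2 * c 1 + 2 * c 2 - 2 * c 3, -c 0 + 2 * c 3 - 2 * c 4,
        -c 0 + 2 * c 4 - 2 * c 5, -c 0 + 2 * c 5, -c 0, -c 0, c 0] : Fin 8 → ℤ) j =
      if extendSigns s j then -1 else 1 := by
  decide +kernel

lemma rootComb_spinCoeffs (s : Fin 5 → Bool)
    (hs : Even ((Finset.univ.filter fun i => s i = true).card)) :
    rootComb (fun i => (spinCoeffs s i : ℝ)) =
      fun j => if extendSigns s j then -(1 : ℝ) / 2 else 1 / 2 := by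
  ext j
  have htwo := congrArg (Int.cast : ℤ → ℝ) (two_mul_coords_spinCoeffs s hs j)
  have hite : (if extendSigns s j then -(1 : ℝ) / 2 else 1 / 2) =
      ((if extendSigns s j then -1 else 1 : ℤ) : ℝ) / 2 := by
    split_ifs <;> norm_num
  rw [hite, ← htwo, rootComb_eq]
  generalize spinCoeffs s = c
  fin_cases j <;> simp <;> ring

lemma mem_PhiK6_zero {α : V} :
    α ∈ PhiK6 0 ↔ ∃ c ∈ cayleyCoeffs, α = rootComb fun i => (c i : ℝ) := by
  constructor
  · rintro ⟨⟨⟨hE8, -⟩, c, hc, rfl⟩, hne⟩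
    change rootComb c ∈ PhiE8 at hE8
    change ip (w6 0) (rootComb c) ≠ 0 at hne
    change ∃ d ∈ cayleyCoeffs, rootComb c = _
    rw [ip_w6_rootComb] at hne
    have hpos : 0 < c 0 := lt_of_le_of_ne (hc 0) hne.symm
    have h5 : rootComb c 5 = -c 0 / 2 := by rw [rootComb_eq]; rfl
    have h6 : rootComb c 6 = -c 0 / 2 := by rw [rootComb_eq]; rfl
    have h7 : rootComb c 7 = c 0 / 2 := by rw [rootComb_eq]; rfl
    rcases hE8 with ⟨i, j, -, s, t, -, -, hα⟩ | ⟨k, hk, hα⟩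
    · exfalso
      have support (l : Fin 8) (hl : rootComb c l ≠ 0) : l = i ∨ l = j := by
        contrapose! hl
        simp [hα, eps, hl.1, hl.2]
      have m5 := support 5 (by rw [h5]; linarith)
      have m6 := support 6 (by rw [h6]; linarith)
      have m7 := support 7 (by rw [h7]; linarith)
      omega
    · rw [sum_sign_smul_eps] at hα
      have k5 : k 5 = true := by
        by_contra hk5
        have := h5.symm.trans (congrFun hα 5)
        simp only [hk5] at this
        norm_num at this
        linarith
      have k6 : k 6 = true := by
        by_contra hk6
        have := h6.symm.trans (congrFun hα 6)
        simp only [hk6] at this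
        norm_num at this
        linarith
      have k7 : k 7 = false := by
        by_contra hk7
        have := h7.symm.trans (congrFun hα 7)
        simp only [Bool.not_eq_false] at hk7
        simp only [hk7] at this
        norm_num at this
        linarith
      have hext : extendSigns (fun i => k (Fin.castLE (by norm_num) i)) = k := by
        ext j
        fin_cases j <;> simp [extendSigns, k5, k6, k7, Fin.castLE]
      rw [← hext, even_card_extendSigns] at hk
      refine ⟨_, mem_cayleyCoeffs_iff.2 ⟨_, hk, rfl⟩, ?_⟩
      rw [rootComb_spinCoeffs _ hk, hext, hα]
  · rintro ⟨c, hc, rfl⟩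
    refine ⟨⟨⟨?_, ?_⟩, fun i => (c i : ℝ), fun i => Nat.cast_nonneg _, rfl⟩, ?_⟩
    · obtain ⟨s, hs, rfl⟩ := mem_cayleyCoeffs_iff.1 hc
      refine Or.inr ⟨extendSigns s, (even_card_extendSigns s).2 hs, ?_⟩
      rw [sum_sign_smul_eps, rootComb_spinCoeffs s hs]
    · exact Submodule.sum_mem _ fun i _ =>
        Submodule.smul_mem _ _ (Submodule.subset_span (Set.mem_range_self i))
    · obtain ⟨s, -, rfl⟩ := mem_cayleyCoeffs_iff.1 hc
      rw [ip_w6_rootComb]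
      simp [spinCoeffs]

/-- The pairings of `∑ bᵢ ϖᵢ` with the positive roots of E6 that involve `α₁`. -/
def pairings (b : Fin 6 → ℕ) : List ℕ :=
  cayleyCoeffs.map fun c =>
    b 0 * c 0 + b 1 * c 1 + b 2 * c 2 + b 3 * c 3 + b 4 * c 4 + b 5 * c 5

lemma mem_T6_zero {a : Fin 6 → ℕ} {r : ℝ} :
    r ∈ T6 a 0 ↔ ∃ m ∈ pairings (fun i => a i + 1), r = m := by
  have hzero : ∀ c ∈ cayleyCoeffs, c 0 = 1 := by decide
  constructor
  · rintro ⟨α, hα, rfl⟩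
    obtain ⟨c, hc, rfl⟩ := mem_PhiK6_zero.1 hα
    refine ⟨_, List.mem_map_of_mem hc, ?_⟩
    rw [ip_lam6_add_rho6_rootComb, ip_w6_rootComb]
    simp [Fin.sum_univ_six, hzero c hc]
  · rintro ⟨m, hm, rfl⟩
    obtain ⟨c, hc, rfl⟩ := List.mem_map.1 hm
    refine ⟨_, mem_PhiK6_zero.2 ⟨c, hc, rfl⟩, ?_⟩
    rw [ip_lam6_add_rho6_rootComb, ip_w6_rootComb]
    simp [Fin.sum_univ_six, hzero c hc]

/-- The pairing with the highest root of E6. -/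
def topPairing (b : Fin 6 → ℕ) : ℕ :=
  b 0 + 2 * b 1 + 2 * b 2 + 3 * b 3 + 2 * b 4 + b 5

lemma topPairing_mem (b : Fin 6 → ℕ) : topPairing b ∈ pairings b := by
  simp [pairings, cayleyCoeffs, topPairing, mul_comm]

lemma bounds_of_mem_pairings {b : Fin 6 → ℕ} {m : ℕ} (hm : m ∈ pairings b) :
    b 0 ≤ m ∧ m ≤ topPairing b := by
  simp only [pairings, cayleyCoeffs, List.map_cons, List.map_nil, List.mem_cons,
    List.not_mem_nil, or_false] at hm
  simp [topPairing] at hm ⊢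
  omega

lemma M6_zero (a : Fin 6 → ℕ) : M6 a 0 = topPairing fun i => a i + 1 := by
  refine IsGreatest.csSup_eq ⟨mem_T6_zero.2 ⟨_, topPairing_mem _, rfl⟩, ?_⟩
  rintro r hr
  obtain ⟨m, hm, rfl⟩ := mem_T6_zero.1 hr
  exact_mod_cast (bounds_of_mem_pairings hm).2

lemma ACM6_zero_iff (a : Fin 6 → ℕ) :
    ACM6 a 0 ↔ ∀ m ∈ Finset.Icc 1 (topPairing fun i => a i + 1),
      m ∈ pairings fun i => a i + 1 := by
  have hcast (m : ℕ) : ((m : ℤ) : ℝ) ∈ T6 a 0 ↔ m ∈ pairings fun i => a i + 1 := by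
    simp [mem_T6_zero]
  constructor
  · intro hacm m hm
    rw [Finset.mem_Icc] at hm
    have : (m : ℤ) ∈ {n : ℤ | (n : ℝ) ∈ T6 a 0} := by
      rw [show {n : ℤ | (n : ℝ) ∈ T6 a 0} = _ from hacm, M6_zero]
      exact ⟨by exact_mod_cast hm.1, by exact_mod_cast hm.2⟩
    exact (hcast m).1 this
  · intro hsub
    ext n
    simp only [Set.mem_ofPred_eq, M6_zero]
    constructor
    · intro hn
      obtain ⟨m, hm, hnm⟩ := mem_T6_zero.1 hn
      have hb := bounds_of_mem_pairings hm
      have hnm' : n = m := by exact_mod_cast hnm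
      subst hnm'
      exact ⟨by omega, by exact_mod_cast hb.2⟩
    · rintro ⟨h1, h2⟩
      lift n to ℕ using by omega
      exact (hcast n).2 (hsub n (Finset.mem_Icc.2 ⟨by exact_mod_cast h1, by exact_mod_cast h2⟩))

/-- There are only sixteen pairings, so they cannot fill a longer interval. -/
lemma topPairing_le_of_forall_mem {b : Fin 6 → ℕ}
    (hb : ∀ m ∈ Finset.Icc 1 (topPairing b), m ∈ pairings b) : topPairing b ≤ 16 := by
  have hsub : Finset.Icc 1 (topPairing b) ⊆ (pairings b).toFinset := fun m hm =>
    List.mem_toFinset.2 (hb m hm)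
  have hcard := (Finset.card_le_card hsub).trans (List.toFinset_card_le _)
  simpa [pairings, cayleyCoeffs] using hcard

lemma coeff_eq_zero_of_forall_mem {a : Fin 6 → ℕ} (h : a 0 = 0)
    (ha : ∀ m ∈ Finset.Icc 1 (topPairing fun i => a i + 1), m ∈ pairings fun i => a i + 1) :
    a 2 = 0 ∧ a 3 = 0 := by
  have h2 := ha 2 (by simp [topPairing]; omega)
  have h3 := ha 3 (by simp [topPairing]; omega)
  simp [pairings, cayleyCoeffs, h] at h2 h3
  omega

lemma forall_mem_pairings_iff : ∀ (p q : Fin 5) (r : Fin 9),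
    (∀ m ∈ Finset.Icc 1 (topPairing ![1, p.1 + 1, 1, 1, q.1 + 1, r.1 + 1]),
        m ∈ pairings ![1, p.1 + 1, 1, 1, q.1 + 1, r.1 + 1]) ↔ p.1 = 0 ∧ q.1 ≤ 1 ∧ r.1 ≤ 3 := by
  decide +kernel

/-- the ACM criterion on the Cayley plane E6/P_{α_1}
    (k = 1 is indexed here by 0). -/
theorem stmt14 (a : Fin 6 → ℕ) (h : a 0 = 0) :
    ACM6 a 0 ↔
      ∃ i j : ℕ, i ≤ 1 ∧ j ≤ 3 ∧ a = ![0, 0, 0, 0, i, j] := by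
  rw [ACM6_zero_iff]
  constructor
  · intro ha
    obtain ⟨h2, h3⟩ := coeff_eq_zero_of_forall_mem h ha
    have htop := topPairing_le_of_forall_mem ha
    simp only [topPairing, h, h2, h3] at htop
    have hb : (fun i => a i + 1) = ![1, a 1 + 1, 1, 1, a 4 + 1, a 5 + 1] := by
      ext i
      fin_cases i <;> simp [h, h2, h3]
    rw [hb] at ha
    obtain ⟨h1, h4, h5⟩ := (forall_mem_pairings_iff ⟨a 1, by omega⟩ ⟨a 4, by omega⟩
      ⟨a 5, by omega⟩).1 ha
    replace h1 : a 1 = 0 := h1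
    refine ⟨a 4, a 5, h4, h5, ?_⟩
    ext i
    fin_cases i <;> simp [h, h1, h2, h3]
  · rintro ⟨i, j, hi, hj, rfl⟩
    have hb : (fun l => (![0, 0, 0, 0, i, j] : Fin 6 → ℕ) l + 1)
        = ![1, 0 + 1, 1, 1, i + 1, j + 1] := by
      ext l
      fin_cases l <;> rfl
    rw [hb]
    exact (forall_mem_pairings_iff 0 ⟨i, by omega⟩ ⟨j, by omega⟩).2 ⟨rfl, hi, hj⟩
end
end
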